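/- Suppose the bitstrings l₁, …, lₙ are pairwise distinct and lₙ is the all-zeros bitstring. Suppose g₁, …, g_{k′} with k′ ≤ 2n − 1 are STM moves such that in the configuration (g_{k′} ⋯ g₁ · t)(C₀) every face is monochromatic, i.e. for each direction d the map sending each surface slot p with direction d to the direction component of (g_{k′} ⋯ g₁ · t)⁻¹(p) is constant. Then the final configuration has the same face colors as C₀: for every surface slot p, the direction component of (g_{k′} ⋯ g₁ · t)⁻¹(p) equals the direction of p. -/

import Mathlib

namespace RC

/-- The six signed coordinate directions. -/
inductive Dir : Type
  | xp | xn | yp | yn | zp | zn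
  deriving DecidableEq

/-- Nonzero slice coordinates of absolute value at most `h`. -/
def I (h : ℕ) : Type := {i : ℤ // i ≠ 0 ∧ |i| ≤ (h : ℤ)}

instance (h : ℕ) : DecidableEq (I h) :=
  inferInstanceAs (DecidableEq {i : ℤ // i ≠ 0 ∧ |i| ≤ (h : ℤ)})

instance (h : ℕ) : Neg (I h) :=
  ⟨fun i => ⟨-i.1, neg_ne_zero.mpr i.2.1, by rw [abs_neg]; exact i.2.2⟩⟩

@[simp] theorem I.neg_neg {h : ℕ} (i : I h) : -(-i) = i :=
  Subtype.ext (by show -(-i.1) = i.1; exact _root_.neg_neg i.1)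

/-- Sticker slots of the cube: a cubie position together with a face direction. -/
abbrev S (h : ℕ) : Type := (I h × I h × I h) × Dir

/-- Rotation of directions by a clockwise `x` turn: fixes `±x`,
`+y ↦ −z ↦ −y ↦ +z ↦ +y`. -/
def rotX : Dir → Dir
  | .xp => .xp | .xn => .xn | .yp => .zn | .zn => .yn | .yn => .zp | .zp => .yp

def rotXi : Dir → Dir
  | .xp => .xp | .xn => .xn | .zn => .yp | .yn => .zn | .zp => .yn | .yp => .zp

/-- Rotation of directions by a clockwise `y` turn: fixes `±y`,
`+z ↦ −x ↦ −z ↦ +x ↦ +z`. -/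
def rotY : Dir → Dir
  | .yp => .yp | .yn => .yn | .zp => .xn | .xn => .zn | .zn => .xp | .xp => .zp

def rotYi : Dir → Dir
  | .yp => .yp | .yn => .yn | .xn => .zp | .zn => .xn | .xp => .zn | .zp => .xp

/-- Rotation of directions by a clockwise `z` turn: fixes `±z`,
`+x ↦ −y ↦ −x ↦ +y ↦ +x`. -/
def rotZ : Dir → Dir
  | .zp => .zp | .zn => .zn | .xp => .yn | .yn => .xn | .xn => .yp | .yp => .xp

def rotZi : Dir → Dir
  | .zp => .zp | .zn => .zn | .yn => .xp | .xn => .yn | .yp => .xn | .xp => .yp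

@[simp] theorem rotXi_rotX (d : Dir) : rotXi (rotX d) = d := by cases d <;> rfl
@[simp] theorem rotX_rotXi (d : Dir) : rotX (rotXi d) = d := by cases d <;> rfl
@[simp] theorem rotYi_rotY (d : Dir) : rotYi (rotY d) = d := by cases d <;> rfl
@[simp] theorem rotY_rotYi (d : Dir) : rotY (rotYi d) = d := by cases d <;> rfl
@[simp] theorem rotZi_rotZ (d : Dir) : rotZi (rotZ d) = d := by cases d <;> rfl
@[simp] theorem rotZ_rotZi (d : Dir) : rotZ (rotZi d) = d := by cases d <;> rfl

/-- Clockwise quarter turn of the `x = v` slice (as seen from positive `x`). -/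
def X {h : ℕ} (v : I h) : Equiv.Perm (S h) where
  toFun s := if s.1.1 = v then ((s.1.1, s.1.2.2, -s.1.2.1), rotX s.2) else s
  invFun s := if s.1.1 = v then ((s.1.1, -s.1.2.2, s.1.2.1), rotXi s.2) else s
  left_inv := by
    rintro ⟨⟨x, y, z⟩, d⟩
    by_cases hx : x = v <;> simp [hx]
  right_inv := by
    rintro ⟨⟨x, y, z⟩, d⟩
    by_cases hx : x = v <;> simp [hx]

/-- Clockwise quarter turn of the `y = v` slice (as seen from positive `y`). -/
def Y {h : ℕ} (v : I h) : Equiv.Perm (S h) where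
  toFun s := if s.1.2.1 = v then ((-s.1.2.2, s.1.2.1, s.1.1), rotY s.2) else s
  invFun s := if s.1.2.1 = v then ((s.1.2.2, s.1.2.1, -s.1.1), rotYi s.2) else s
  left_inv := by
    rintro ⟨⟨x, y, z⟩, d⟩
    by_cases hy : y = v <;> simp [hy]
  right_inv := by
    rintro ⟨⟨x, y, z⟩, d⟩
    by_cases hy : y = v <;> simp [hy]

/-- Clockwise quarter turn of the `z = v` slice (as seen from positive `z`). -/
def Z {h : ℕ} (v : I h) : Equiv.Perm (S h) where
  toFun s := if s.1.2.2 = v then ((s.1.2.1, -s.1.1, s.1.2.2), rotZ s.2) else s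
  invFun s := if s.1.2.2 = v then ((-s.1.2.1, s.1.1, s.1.2.2), rotZi s.2) else s
  left_inv := by
    rintro ⟨⟨x, y, z⟩, d⟩
    by_cases hz : z = v <;> simp [hz]
  right_inv := by
    rintro ⟨⟨x, y, z⟩, d⟩
    by_cases hz : z = v <;> simp [hz]

/-- The side-length parameter: `h = m + 3n`. -/
abbrev hC (n m : ℕ) : ℕ := m + 3 * n

def bit {m : ℕ} (w : Fin m → Bool) (c : ℤ) : Bool :=
  if hc : 1 ≤ c ∧ c ≤ (m : ℤ) then w ⟨(c - 1).toNat, by omega⟩ else false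

/-- The `x`-slice index corresponding to bit position `j`. -/
def colIdx {n m : ℕ} (j : Fin m) : I (hC n m) :=
  ⟨((j : ℕ) : ℤ) + 1, by
    have hj : (j : ℕ) < m := j.isLt
    constructor
    · omega
    · rw [abs_of_nonneg (by omega)]; push_cast; omega⟩

/-- The `z`-slice index `m + i` corresponding to row `i`. -/
def zIdx {n m : ℕ} (i : Fin n) : I (hC n m) :=
  ⟨(m : ℤ) + ((i : ℕ) : ℤ) + 1, by
    have hi : (i : ℕ) < n := i.isLt
    constructor
    · omega
    · rw [abs_of_nonneg (by omega)]; push_cast; omega⟩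

/-- The face coordinate `h`. -/
def topI {n m : ℕ} (H : 0 < m + 3 * n) : I (hC n m) :=
  ⟨(m : ℤ) + 3 * (n : ℤ), by
    constructor
    · omega
    · rw [abs_of_nonneg (by omega)]; push_cast; omega⟩

/-- `aᵢ := (X 1)^{lᵢ(1)} ⋯ (X m)^{lᵢ(m)}`. -/
def a {n m : ℕ} (l : Fin n → Fin m → Bool) (i : Fin n) : Equiv.Perm (S (hC n m)) :=
  ((List.finRange m).map (fun j => X (colIdx (n := n) j) ^ (if l i j then 1 else 0))).prod

/-- `bᵢ := aᵢ⁻¹ · (Z (m+i)) · aᵢ`. -/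
def b {n m : ℕ} (l : Fin n → Fin m → Bool) (i : Fin n) : Equiv.Perm (S (hC n m)) :=
  (a l i)⁻¹ * Z (zIdx (m := m) i) * a l i

/-- `t := a₁ · b₁ · b₂ ⋯ bₙ`. -/
def t {n m : ℕ} (hn : 0 < n) (l : Fin n → Fin m → Bool) : Equiv.Perm (S (hC n m)) :=
  a l ⟨0, hn⟩ * ((List.finRange n).map (b l)).prod

/-- A slot is a surface slot if its cubie is on the face its direction points to. -/
def IsSurface {h : ℕ} (s : S h) : Prop :=
  match s.2 with
  | .xp => s.1.1.1 = (h : ℤ)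
  | .xn => s.1.1.1 = -(h : ℤ)
  | .yp => s.1.2.1.1 = (h : ℤ)
  | .yn => s.1.2.1.1 = -(h : ℤ)
  | .zp => s.1.2.2.1 = (h : ℤ)
  | .zn => s.1.2.2.1 = -(h : ℤ)

/-- An STM move: a nontrivial rotation of a single slice. -/
def IsSTM {h : ℕ} (g : Equiv.Perm (S h)) : Prop :=
  ∃ (v : I h) (e : ℕ), (e = 1 ∨ e = 2 ∨ e = 3) ∧
    (g = X v ^ e ∨ g = Y v ^ e ∨ g = Z v ^ e)


/-- A surface slot whose two coordinates within its face both have absolute value `u`. -/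
def OnDiagonal {h : ℕ} (u : ℕ) (s : S h) : Prop :=
  IsSurface s ∧
    match s.2 with
    | .xp | .xn => s.1.2.1.1.natAbs = u ∧ s.1.2.2.1.natAbs = u
    | .yp | .yn => s.1.1.1.natAbs = u ∧ s.1.2.2.1.natAbs = u
    | .zp | .zn => s.1.1.1.natAbs = u ∧ s.1.2.1.1.natAbs = u

theorem I.neg_val {h : ℕ} (i : I h) : (-i).1 = -i.1 := rfl

/-- The permutations that map the diagonal slots of each face to diagonal slots of the same face,
in both directions. -/
def diagonalStabilizer (h u : ℕ) : Subgroup (Equiv.Perm (S h)) where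
  carrier := {σ | ∀ s, OnDiagonal u s →
    (OnDiagonal u (σ s) ∧ (σ s).2 = s.2) ∧ (OnDiagonal u (σ⁻¹ s) ∧ (σ⁻¹ s).2 = s.2)}
  one_mem' s hs := ⟨⟨hs, rfl⟩, ⟨hs, rfl⟩⟩
  mul_mem' {σ τ} hσ hτ s hs := by
    have h₁ := (hτ s hs).1
    have h₂ := (hσ _ h₁.1).1
    have h₃ := (hσ s hs).2
    have h₄ := (hτ _ h₃.1).2
    rw [mul_inv_rev]
    exact ⟨⟨h₂.1, h₂.2.trans h₁.2⟩, ⟨h₄.1, h₄.2.trans h₃.2⟩⟩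
  inv_mem' {σ} hσ s hs := by
    rw [inv_inv]
    exact (hσ s hs).symm

theorem X_mem_diagonalStabilizer {h u : ℕ} {v : I h} (hv : v.1.natAbs ≠ u) :
    X v ∈ diagonalStabilizer h u := by
  rintro ⟨⟨x, y, z⟩, d⟩ hs
  by_cases hx : x = v
  · subst hx
    cases d <;> simp_all [OnDiagonal, IsSurface, X, Equiv.Perm.inv_def, I.neg_val, rotX, rotXi]
  · exact ⟨by simp [X, hx, hs], by simp [X, Equiv.Perm.inv_def, hx, hs]⟩

theorem Y_mem_diagonalStabilizer {h u : ℕ} {v : I h} (hv : v.1.natAbs ≠ u) :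
    Y v ∈ diagonalStabilizer h u := by
  rintro ⟨⟨x, y, z⟩, d⟩ hs
  by_cases hy : y = v
  · subst hy
    cases d <;> simp_all [OnDiagonal, IsSurface, Y, Equiv.Perm.inv_def, I.neg_val, rotY, rotYi]
  · exact ⟨by simp [Y, hy, hs], by simp [Y, Equiv.Perm.inv_def, hy, hs]⟩

theorem Z_mem_diagonalStabilizer {h u : ℕ} {v : I h} (hv : v.1.natAbs ≠ u) :
    Z v ∈ diagonalStabilizer h u := by
  rintro ⟨⟨x, y, z⟩, d⟩ hs
  by_cases hz : z = v
  · subst hz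
    cases d <;> simp_all [OnDiagonal, IsSurface, Z, Equiv.Perm.inv_def, I.neg_val, rotZ, rotZi]
  · exact ⟨by simp [Z, hz, hs], by simp [Z, Equiv.Perm.inv_def, hz, hs]⟩

theorem a_mem_diagonalStabilizer {n m u : ℕ} (hu : m < u) (l : Fin n → Fin m → Bool)
    (i : Fin n) : a l i ∈ diagonalStabilizer (hC n m) u := by
  refine Subgroup.list_prod_mem _ fun σ hσ => ?_
  obtain ⟨j, -, rfl⟩ := List.mem_map.1 hσ
  refine pow_mem (X_mem_diagonalStabilizer ?_) _
  have := j.isLt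
  simp only [colIdx]
  omega

theorem b_mem_diagonalStabilizer {n m u : ℕ} (hu : m + n < u) (l : Fin n → Fin m → Bool)
    (i : Fin n) : b l i ∈ diagonalStabilizer (hC n m) u := by
  have ha := a_mem_diagonalStabilizer (by omega : m < u) l i
  refine mul_mem (mul_mem (inv_mem ha) (Z_mem_diagonalStabilizer ?_)) ha
  have := i.isLt
  simp only [zIdx]
  omega

theorem t_mem_diagonalStabilizer {n m u : ℕ} (hn : 0 < n) (hu : m + n < u)
    (l : Fin n → Fin m → Bool) : t hn l ∈ diagonalStabilizer (hC n m) u := by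
  refine mul_mem (a_mem_diagonalStabilizer (by omega) l _)
    (Subgroup.list_prod_mem _ fun σ hσ => ?_)
  obtain ⟨i, -, rfl⟩ := List.mem_map.1 hσ
  exact b_mem_diagonalStabilizer hu l i

theorem IsSTM.exists_index {h : ℕ} {g : Equiv.Perm (S h)} (hg : IsSTM g) :
    ∃ w : ℕ, ∀ u, u ≠ w → g ∈ diagonalStabilizer h u := by
  obtain ⟨v, e, -, rfl | rfl | rfl⟩ := hg
  · exact ⟨v.1.natAbs, fun u hu => pow_mem (X_mem_diagonalStabilizer hu.symm) e⟩
  · exact ⟨v.1.natAbs, fun u hu => pow_mem (Y_mem_diagonalStabilizer hu.symm) e⟩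
  · exact ⟨v.1.natAbs, fun u hu => pow_mem (Z_mem_diagonalStabilizer hu.symm) e⟩

theorem exists_onDiagonal {h u : ℕ} (hu : 0 < u) (huh : u ≤ h) (d : Dir) :
    ∃ s : S h, OnDiagonal u s ∧ s.2 = d := by
  let c : I h := ⟨u, by omega, by rw [abs_of_nonneg] <;> omega⟩
  let f : I h := ⟨h, by omega, by rw [abs_of_nonneg]; omega⟩
  have hf : (-f).1 = -(h : ℤ) := rfl
  cases d
  · exact ⟨((f, c, c), .xp), by simp [OnDiagonal, IsSurface, c, f], rfl⟩
  · exact ⟨((-f, c, c), .xn), by simp [OnDiagonal, IsSurface, c, hf], rfl⟩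
  · exact ⟨((c, f, c), .yp), by simp [OnDiagonal, IsSurface, c, f], rfl⟩
  · exact ⟨((c, -f, c), .yn), by simp [OnDiagonal, IsSurface, c, hf], rfl⟩
  · exact ⟨((c, c, f), .zp), by simp [OnDiagonal, IsSurface, c, f], rfl⟩
  · exact ⟨((c, c, -f), .zn), by simp [OnDiagonal, IsSurface, c, hf], rfl⟩

/-- if a ≤ 2n−1 STM move sequence makes every face monochromatic, then the
final configuration has the same face colors as `C₀`. -/
theorem stmt_18 (n m : ℕ) (hn : 0 < n) (hm : 0 < m) (l : Fin n → Fin m → Bool)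
    (hdist : Function.Injective l)
    (hlast : l ⟨n - 1, by omega⟩ = fun _ => false)
    (k' : ℕ) (hk : k' ≤ 2 * n - 1) (g : Fin k' → Equiv.Perm (S (hC n m)))
    (hSTM : ∀ q, IsSTM (g q))
    (hmono : ∀ d : Dir, ∃ d₀ : Dir, ∀ p : S (hC n m), IsSurface p → p.2 = d →
      (((List.ofFn g).reverse.prod * t hn l)⁻¹ p).2 = d₀) :
    ∀ p : S (hC n m), IsSurface p →
      (((List.ofFn g).reverse.prod * t hn l)⁻¹ p).2 = p.2 := by
  choose w hw using fun q => (hSTM q).exists_index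
  obtain ⟨u, hu, huw⟩ : ∃ u ∈ Finset.Ioc (m + n) (m + 3 * n), u ∉ Finset.univ.image w := by
    refine Finset.exists_mem_notMem_of_card_lt_card (Finset.card_image_le.trans_lt ?_)
    rw [Finset.card_univ, Fintype.card_fin, Nat.card_Ioc]
    omega
  rw [Finset.mem_Ioc] at hu
  have hmem : (List.ofFn g).reverse.prod * t hn l ∈ diagonalStabilizer (hC n m) u := by
    refine mul_mem (Subgroup.list_prod_mem _ fun σ hσ => ?_) (t_mem_diagonalStabilizer hn hu.1 l)
    obtain ⟨q, rfl⟩ := List.mem_ofFn.1 (List.mem_reverse.1 hσ)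
    exact hw q u fun h => huw (Finset.mem_image.2 ⟨q, Finset.mem_univ q, h.symm⟩)
  intro p hp
  obtain ⟨d₀, hd₀⟩ := hmono p.2
  obtain ⟨s, hs, hsd⟩ := exists_onDiagonal (h := hC n m) (by omega) hu.2 p.2
  rw [hd₀ p hp rfl, ← hd₀ s hs.1 hsd, (hmem s hs).2.2, hsd]

end RC
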